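/- arXiv:2504.03232 — 3 statements merged into one kernel-verified Lean document; each statement's English description precedes it below -/
import Mathlib

section
/- There exists a constant C > 0 such that for all 0 < t ≤ 1 and all y ∈ ℝ³, one has ∫_{ℝ³} |−(Δ_y K_t)(y,w) + |y|²·K_t(y,w)| dw ≤ C · t^{−1}, where Δ_y denotes the Laplacian acting on the first variable. -/
open MeasureTheory Real

noncomputable section

/-- Mehler heat kernel of the harmonic oscillator `H = -Δ + |x|²` on `ℝ³`. -/
def mehlerK (t : ℝ) (x y : EuclideanSpace ℝ (Fin 3)) : ℝ :=
  (2 * π * Real.sinh (2 * t)) ^ (-(3 : ℝ) / 2) *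
    Real.exp (-‖x - y‖ ^ 2 / (4 * Real.tanh t) - Real.tanh t * ‖x + y‖ ^ 2 / 4)

/-- The Laplacian of a function on `ℝ³`: the sum of the pure second derivatives
in the coordinate directions. -/
def lapl (f : EuclideanSpace ℝ (Fin 3) → ℝ) (x : EuclideanSpace ℝ (Fin 3)) : ℝ :=
  ∑ i : Fin 3,
    iteratedFDeriv ℝ 2 f x ![EuclideanSpace.single i (1 : ℝ), EuclideanSpace.single i (1 : ℝ)]

/-- The gradient in `z` of the exponent `-a‖z - w‖² - b‖z + w‖²`. -/
def gaussGrad (a b : ℝ) (w z : EuclideanSpace ℝ (Fin 3)) : EuclideanSpace ℝ (Fin 3) :=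
  (-(2 * a)) • (z - w) + (-(2 * b)) • (z + w)

lemma hasFDerivAt_const_mul_exp (c a b : ℝ) (w z : EuclideanSpace ℝ (Fin 3)) :
    HasFDerivAt (fun z => c * exp (-a * ‖z - w‖ ^ 2 - b * ‖z + w‖ ^ 2))
      ((c * exp (-a * ‖z - w‖ ^ 2 - b * ‖z + w‖ ^ 2)) • innerSL ℝ (gaussGrad a b w z)) z := by
  have h1 := (((hasFDerivAt_id (𝕜 := ℝ) z).sub_const w).norm_sq).const_mul (-a)
  have h2 := (((hasFDerivAt_id (𝕜 := ℝ) z).add_const w).norm_sq).const_mul b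
  refine ((h1.sub h2).exp.const_mul c).congr_fderiv ?_
  ext v
  simp [gaussGrad]
  ring

lemma lapl_const_mul_exp (c a b : ℝ) (w z : EuclideanSpace ℝ (Fin 3)) :
    lapl (fun z => c * exp (-a * ‖z - w‖ ^ 2 - b * ‖z + w‖ ^ 2)) z =
      (‖gaussGrad a b w z‖ ^ 2 - 6 * (a + b)) *
        (c * exp (-a * ‖z - w‖ ^ 2 - b * ‖z + w‖ ^ 2)) := by
  have hf : fderiv ℝ (fun z => c * exp (-a * ‖z - w‖ ^ 2 - b * ‖z + w‖ ^ 2)) =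
      fun z => (c * exp (-a * ‖z - w‖ ^ 2 - b * ‖z + w‖ ^ 2)) •
        innerSL ℝ (gaussGrad a b w z) :=
    funext fun z => (hasFDerivAt_const_mul_exp c a b w z).fderiv
  have hg : HasFDerivAt (gaussGrad a b w)
      ((-(2 * a)) • ContinuousLinearMap.id ℝ _ + (-(2 * b)) • ContinuousLinearMap.id ℝ _) z :=
    (((hasFDerivAt_id (𝕜 := ℝ) z).sub_const w).const_smul (-(2 * a))).add
      (((hasFDerivAt_id (𝕜 := ℝ) z).add_const w).const_smul (-(2 * b)))
  have hL := ((innerSL ℝ (E := EuclideanSpace ℝ (Fin 3))).hasFDerivAt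
    (x := gaussGrad a b w z)).comp z hg
  have h2 := ((hasFDerivAt_const_mul_exp c a b w z).smul hL).fderiv
  simp only [Function.comp_def, Pi.smul_def'] at h2
  unfold lapl
  simp only [iteratedFDeriv_two_apply, hf, h2]
  rw [EuclideanSpace.norm_sq_eq (gaussGrad a b w z)]
  simp [Fin.sum_univ_three, innerSL_apply_apply ℝ, EuclideanSpace.inner_single_right]
  ring

lemma tanh_pos_of_pos {t : ℝ} (ht : 0 < t) : 0 < tanh t := by
  rw [Real.tanh_eq_sinh_div_cosh]
  exact div_pos (Real.sinh_pos_iff.2 ht) (Real.cosh_pos t)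

lemma oscillator_mehlerK {t : ℝ} (ht : 0 < t) (y w : EuclideanSpace ℝ (Fin 3)) :
    -(lapl (fun z => mehlerK t z w) y) + ‖y‖ ^ 2 * mehlerK t y w =
      (3 / (2 * tanh t) + 3 * tanh t / 2 + (1 / 4 - 1 / (4 * tanh t ^ 2)) * ‖y - w‖ ^ 2 +
        (1 / 4 - tanh t ^ 2 / 4) * ‖y + w‖ ^ 2) * mehlerK t y w := by
  have hτ : 0 < tanh t := tanh_pos_of_pos ht
  have hK : (fun z => mehlerK t z w) = fun z => (2 * π * Real.sinh (2 * t)) ^ (-(3 : ℝ) / 2) *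
      exp (-(1 / (4 * tanh t)) * ‖z - w‖ ^ 2 - tanh t / 4 * ‖z + w‖ ^ 2) := by
    funext z
    unfold mehlerK
    congr 2
    ring
  have hy := congrFun hK y
  rw [hK, lapl_const_mul_exp, ← hy]
  have hn : ‖gaussGrad (1 / (4 * tanh t)) (tanh t / 4) w y‖ ^ 2 - ‖y‖ ^ 2 =
      (1 / (4 * tanh t ^ 2) - 1 / 4) * ‖y - w‖ ^ 2 + (tanh t ^ 2 / 4 - 1 / 4) * ‖y + w‖ ^ 2 := by
    simp only [gaussGrad, ← real_inner_self_eq_norm_sq, inner_add_left, inner_add_right,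
      inner_sub_left, inner_sub_right, inner_smul_left, inner_smul_right,
      real_inner_comm y w, conj_trivial]
    field_simp
    ring
  have hn' : 6 * (1 / (4 * tanh t) + tanh t / 4) = 3 / (2 * tanh t) + 3 * tanh t / 2 := by
    field_simp
    ring
  rw [← hn']
  linear_combination (-mehlerK t y w) * hn

lemma abs_oscillator_mehlerK_le {t : ℝ} (ht : 0 < t) (y w : EuclideanSpace ℝ (Fin 3)) :
    |(-(lapl (fun z => mehlerK t z w) y) + ‖y‖ ^ 2 * mehlerK t y w)| ≤
      6 / tanh t * (2 * π * Real.sinh (2 * t)) ^ (-(3 : ℝ) / 2) *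
        exp (-(1 / (8 * tanh t)) * ‖y - w‖ ^ 2) := by
  have hτ : 0 < tanh t := tanh_pos_of_pos ht
  have hτ1 : tanh t < 1 := Real.tanh_lt_one t
  rw [oscillator_mehlerK ht]
  unfold mehlerK
  set τ := tanh t
  have hc : 0 ≤ (2 * π * Real.sinh (2 * t)) ^ (-(3 : ℝ) / 2) := by
    have : 0 < Real.sinh (2 * t) := Real.sinh_pos_iff.2 (by linarith)
    positivity
  set c := (2 * π * Real.sinh (2 * t)) ^ (-(3 : ℝ) / 2)
  set p := ‖y - w‖ ^ 2 / (8 * τ) with hp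
  set q := τ * ‖y + w‖ ^ 2 / 4 with hq
  have hp0 : 0 ≤ p := by positivity
  have hq0 : 0 ≤ q := by positivity
  have hu : ‖y - w‖ ^ 2 = 8 * τ * p := by rw [hp]; field_simp
  have hv : ‖y + w‖ ^ 2 = 4 * q / τ := by rw [hq]; field_simp
  have e1 : -‖y - w‖ ^ 2 / (4 * τ) - q = -p + (-p + -q) := by rw [hu]; field_simp; ring
  have e2 : -(1 / (8 * τ)) * ‖y - w‖ ^ 2 = -p := by rw [hu]; field_simp
  rw [e1, e2, exp_add, hu, hv]
  have hpoly : |3 / (2 * τ) + 3 * τ / 2 + (1 / 4 - 1 / (4 * τ ^ 2)) * (8 * τ * p) +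
      (1 / 4 - τ ^ 2 / 4) * (4 * q / τ)| ≤ 6 / τ * exp (p + q) := by
    have h : 3 / (2 * τ) + 3 * τ / 2 + (1 / 4 - 1 / (4 * τ ^ 2)) * (8 * τ * p) +
      (1 / 4 - τ ^ 2 / 4) * (4 * q / τ) =
        (3 / 2 + 3 / 2 * τ ^ 2 - 2 * (1 - τ ^ 2) * p + (1 - τ ^ 2) * q) / τ := by
      field_simp
      ring
    rw [h, abs_div, abs_of_pos hτ, div_mul_eq_mul_div 6 τ]
    refine div_le_div_of_nonneg_right ?_ hτ.le
    have hs : τ ^ 2 ≤ 1 := by nlinarith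
    have := add_one_le_exp (p + q)
    have h1 : 0 ≤ (1 - τ ^ 2) * p := mul_nonneg (by linarith) hp0
    have h2 : 0 ≤ (1 - τ ^ 2) * q := mul_nonneg (by linarith) hq0
    have h3 : 0 ≤ τ ^ 2 * p := by positivity
    have h4 : 0 ≤ τ ^ 2 * q := by positivity
    rw [abs_le]
    constructor <;> nlinarith
  have hexp : exp (p + q) * exp (-p + -q) = 1 := by
    rw [← exp_add, ← exp_zero]
    congr 1
    ring
  rw [abs_mul, abs_of_nonneg (by positivity : 0 ≤ c * (exp (-p) * exp (-p + -q)))]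
  calc _ ≤ 6 / τ * exp (p + q) * (c * (exp (-p) * exp (-p + -q))) := by gcongr
    _ = 6 / τ * c * exp (-p) * (exp (p + q) * exp (-p + -q)) := by ring
    _ = _ := by rw [hexp, mul_one]

lemma integral_exp_neg_mul_norm_sub_sq {b : ℝ} (hb : 0 < b) (y : EuclideanSpace ℝ (Fin 3)) :
    ∫ w, exp (-b * ‖y - w‖ ^ 2) = (π / b) ^ ((3 : ℝ) / 2) := by
  rw [integral_sub_left_eq_self (fun v : EuclideanSpace ℝ (Fin 3) => exp (-b * ‖v‖ ^ 2)) volume y,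
    GaussianFourier.integral_rexp_neg_mul_sq_norm hb]
  simp

lemma mehlerK_normalization_le {t : ℝ} (ht : 0 < t) :
    (2 * π * Real.sinh (2 * t)) ^ (-(3 : ℝ) / 2) * (π / (1 / (8 * tanh t))) ^ ((3 : ℝ) / 2) ≤
      2 ^ ((3 : ℝ) / 2) := by
  have hs : 0 < Real.sinh t := Real.sinh_pos_iff.2 ht
  have hc : 1 ≤ Real.cosh t := Real.one_le_cosh t
  have h2 : 0 < Real.sinh (2 * t) := Real.sinh_pos_iff.2 (by linarith)
  have hτ : 0 < tanh t := tanh_pos_of_pos ht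
  rw [neg_div, rpow_neg (by positivity), inv_mul_eq_div, ← div_rpow (by positivity) (by positivity)]
  refine rpow_le_rpow (by positivity) ?_ (by norm_num)
  rw [Real.tanh_eq_sinh_div_cosh, Real.sinh_two_mul]
  have : π / (1 / (8 * (Real.sinh t / Real.cosh t))) / (2 * π * (2 * Real.sinh t * Real.cosh t)) =
      2 / Real.cosh t ^ 2 := by
    field_simp
    norm_num
  rw [this, div_le_iff₀ (by positivity)]
  nlinarith

lemma inv_tanh_le {t : ℝ} (ht : 0 < t) (ht1 : t ≤ 1) : (tanh t)⁻¹ ≤ 3 * t⁻¹ := by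
  have hs : t ≤ Real.sinh t := Real.self_le_sinh_iff.2 ht.le
  have hc : Real.cosh t ≤ 3 := by
    have h1 : Real.cosh t ≤ exp t := by
      rw [← Real.cosh_add_sinh]
      linarith
    have h2 : exp t ≤ exp 1 := exp_le_exp.2 ht1
    linarith [Real.exp_one_lt_d9]
  rw [Real.tanh_eq_sinh_div_cosh, inv_div, ← div_eq_mul_inv]
  gcongr

/-- `∫ |H_y K_t(y,w)| dw ≤ C t⁻¹` for `0 < t ≤ 1`, where `H_y` is the
harmonic oscillator acting in the first variable. -/
theorem harmonic_oscillator_heat_kernel_L1_bound :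
    ∃ C : ℝ, 0 < C ∧
      ∀ t : ℝ, 0 < t → t ≤ 1 → ∀ y : EuclideanSpace ℝ (Fin 3),
        (∫ w, |(-(lapl (fun z => mehlerK t z w) y) + ‖y‖ ^ 2 * mehlerK t y w)|) ≤ C * t⁻¹ := by
  refine ⟨18 * 2 ^ ((3 : ℝ) / 2), by positivity, fun t ht ht1 y => ?_⟩
  have hτ : 0 < tanh t := tanh_pos_of_pos ht
  have hb : 0 < 1 / (8 * tanh t) := by positivity
  have hint := integral_exp_neg_mul_norm_sub_sq hb y
  have hi : Integrable fun w => exp (-(1 / (8 * tanh t)) * ‖y - w‖ ^ 2) := by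
    refine .of_integral_ne_zero ?_
    rw [hint]
    positivity
  calc _ ≤ ∫ w, 6 / tanh t * (2 * π * Real.sinh (2 * t)) ^ (-(3 : ℝ) / 2) *
        exp (-(1 / (8 * tanh t)) * ‖y - w‖ ^ 2) :=
        integral_mono_of_nonneg (.of_forall fun w => abs_nonneg _) (hi.const_mul _)
          (.of_forall fun w => abs_oscillator_mehlerK_le ht y w)
    _ = 6 * (tanh t)⁻¹ * ((2 * π * Real.sinh (2 * t)) ^ (-(3 : ℝ) / 2) *
        (π / (1 / (8 * tanh t))) ^ ((3 : ℝ) / 2)) := by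
      rw [integral_const_mul, hint]
      ring
    _ ≤ 6 * (3 * t⁻¹) * 2 ^ ((3 : ℝ) / 2) := by
      gcongr
      · exact inv_tanh_le ht ht1
      · exact mehlerK_normalization_le ht
    _ = _ := by ring

end
end

section
/- For every 0 < ε < 1 there exists a constant C_ε > 0, independent of the times, such that for all t₁, t₂ ≥ 0 with t₁ ≠ t₂ and all integers n ≥ 1, one has ∫_{ℝ³} (sup_{y₂ ∈ ℝ³} 𝒞⁽ⁿ⁾_{t₁,t₂}(y₁+y₂, y₂))³ dy₁ ≤ C_ε · |t₂−t₁|^{−ε}. -/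
open MeasureTheory Real

noncomputable section

/-- The regularized covariance `𝒞⁽ⁿ⁾_{t₁,t₂}(y₁,y₂)`, with `ε_n = 2^{-n}`. -/
def covC (n : ℕ) (t₁ t₂ : ℝ) (y₁ y₂ : EuclideanSpace ℝ (Fin 3)) : ℝ :=
  (1 / 2) * ∫ σ in (|t₂ - t₁| + 2 * (2 : ℝ) ^ (-(n : ℝ)))..(t₁ + t₂ + 2 * (2 : ℝ) ^ (-(n : ℝ))),
    mehlerK σ y₁ y₂

theorem tanh_le_self_of_nonneg {x : ℝ} (hx : 0 ≤ x) : Real.tanh x ≤ x := by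
  have hmono : MonotoneOn (fun y : ℝ => y * Real.cosh y - Real.sinh y) (Set.Ici 0) := by
    refine monotoneOn_of_deriv_nonneg (convex_Ici 0) (by fun_prop) (by fun_prop) ?_
    intro y hy
    rw [interior_Ici] at hy
    have hd : HasDerivAt (fun y : ℝ => y * Real.cosh y - Real.sinh y)
        (1 * Real.cosh y + y * Real.sinh y - Real.cosh y) y :=
      ((hasDerivAt_id y).mul (Real.hasDerivAt_cosh y)).sub (Real.hasDerivAt_sinh y)
    rw [hd.deriv]
    have := mul_nonneg (le_of_lt hy) (Real.sinh_nonneg_iff.2 (le_of_lt hy))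
    linarith
  have h := hmono (Set.mem_Ici.2 le_rfl) (Set.mem_Ici.2 hx) hx
  simp only [zero_mul, Real.sinh_zero, sub_zero] at h
  rw [Real.tanh_eq_sinh_div_cosh, div_le_iff₀ (Real.cosh_pos x)]
  linarith

theorem exp_neg_le_rpow_neg {x α : ℝ} (hx : 0 < x) (hα0 : 0 ≤ α) (hα1 : α ≤ 1) :
    Real.exp (-x) ≤ x ^ (-α) := by
  rw [Real.exp_neg, Real.rpow_neg hx.le]
  refine inv_anti₀ (Real.rpow_pos_of_pos hx α) ?_
  rcases le_total x 1 with h | h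
  · exact (Real.rpow_le_one hx.le h hα0).trans (Real.one_le_exp hx.le)
  · calc x ^ α ≤ x ^ (1 : ℝ) := Real.rpow_le_rpow_of_exponent_le h hα1
      _ = x := Real.rpow_one x
      _ ≤ Real.exp x := by linarith [Real.add_one_le_exp x]

theorem mehlerK_nonneg {σ : ℝ} (hσ : 0 < σ) (x y : EuclideanSpace ℝ (Fin 3)) :
    0 ≤ mehlerK σ x y := by
  have : 0 < Real.sinh (2 * σ) := Real.sinh_pos_iff.2 (by linarith)
  unfold mehlerK
  positivity

theorem mehlerK_le {σ α : ℝ} (hσ : 0 < σ) (hα0 : 0 ≤ α) (hα1 : α ≤ 1)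
    {x y : EuclideanSpace ℝ (Fin 3)} (hxy : x ≠ y) :
    mehlerK σ x y ≤
      8 * (Real.exp (-(1 / 8) * ‖x - y‖ ^ 2) * ‖x - y‖ ^ (-(2 * α))) * σ ^ (α - 3 / 2) := by
  have hr : 0 < ‖x - y‖ := norm_pos_iff.2 (sub_ne_zero.2 hxy)
  set r := ‖x - y‖
  have hsinh : 2 * σ ≤ Real.sinh (2 * σ) := Real.self_le_sinh_iff.2 (by linarith)
  have hT0 : 0 < Real.tanh σ := by
    rw [Real.tanh_eq_sinh_div_cosh]
    exact div_pos (Real.sinh_pos_iff.2 hσ) (Real.cosh_pos σ)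
  have hT1 : Real.tanh σ ≤ 1 := (Real.tanh_lt_one σ).le
  have hTσ : Real.tanh σ ≤ σ := tanh_le_self_of_nonneg hσ.le
  have hpre : (2 * π * Real.sinh (2 * σ)) ^ (-(3 : ℝ) / 2) ≤ σ ^ (-(3 : ℝ) / 2) := by
    refine Real.rpow_le_rpow_of_nonpos hσ ?_ (by norm_num)
    nlinarith [Real.pi_gt_three]
  have h1 : r ^ 2 / 8 ≤ r ^ 2 / (8 * Real.tanh σ) := by
    gcongr
    linarith
  have h2 : r ^ 2 / (8 * σ) ≤ r ^ 2 / (8 * Real.tanh σ) := by gcongr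
  have h3 : r ^ 2 / (4 * Real.tanh σ) = r ^ 2 / (8 * Real.tanh σ) + r ^ 2 / (8 * Real.tanh σ) := by
    field_simp
    norm_num
  have h4 : 0 ≤ Real.tanh σ * ‖x + y‖ ^ 2 / 4 := by positivity
  have hexp : Real.exp (-r ^ 2 / (4 * Real.tanh σ) - Real.tanh σ * ‖x + y‖ ^ 2 / 4) ≤
      Real.exp (-(1 / 8) * r ^ 2) * Real.exp (-(r ^ 2 / (8 * σ))) := by
    rw [← Real.exp_add, Real.exp_le_exp, neg_div]
    linarith
  have hpow : Real.exp (-(r ^ 2 / (8 * σ))) ≤ 8 * r ^ (-(2 * α)) * σ ^ α := by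
    refine (exp_neg_le_rpow_neg (by positivity) hα0 hα1).trans ?_
    rw [Real.div_rpow (by positivity) (by positivity), Real.mul_rpow (by norm_num) hσ.le,
      ← Real.rpow_natCast r 2, ← Real.rpow_mul hr.le, Real.rpow_neg (by norm_num) α,
      Real.rpow_neg hσ.le, ← mul_inv, div_inv_eq_mul]
    have h8 : (8 : ℝ) ^ α ≤ 8 := by
      simpa using Real.rpow_le_rpow_of_exponent_le (by norm_num : (1 : ℝ) ≤ 8) hα1
    have he : ((2 : ℕ) : ℝ) * -α = -(2 * α) := by push_cast; ring
    rw [he]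
    calc r ^ (-(2 * α)) * (8 ^ α * σ ^ α) ≤ r ^ (-(2 * α)) * (8 * σ ^ α) := by gcongr
      _ = _ := by ring
  calc mehlerK σ x y
      ≤ σ ^ (-(3 : ℝ) / 2) *
          (Real.exp (-(1 / 8) * r ^ 2) * (8 * r ^ (-(2 * α)) * σ ^ α)) := by
        unfold mehlerK
        gcongr
        exact hexp.trans (by gcongr)
    _ = 8 * (Real.exp (-(1 / 8) * r ^ 2) * r ^ (-(2 * α))) * (σ ^ α * σ ^ (-(3 : ℝ) / 2)) := by
        ring
    _ = _ := by
        rw [← Real.rpow_add hσ]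
        ring_nf

theorem integral_rpow_neg_one_sub_le {a b δ : ℝ} (ha : 0 < a) (hab : a ≤ b) (hδ : 0 < δ) :
    ∫ σ in a..b, σ ^ (-1 - δ) ≤ a ^ (-δ) / δ := by
  have h0 : (0 : ℝ) ∉ Set.uIcc a b := by
    rw [Set.uIcc_of_le hab]
    exact fun h => absurd h.1 (not_le.2 ha)
  rw [integral_rpow (Or.inr ⟨by linarith, h0⟩), show -1 - δ + 1 = -δ by ring, div_neg,
    ← neg_div]
  have := Real.rpow_nonneg (ha.le.trans hab) (-δ)
  gcongr
  linarith

theorem covC_nonneg {n : ℕ} {t₁ t₂ : ℝ} (h₁ : 0 ≤ t₁) (h₂ : 0 ≤ t₂)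
    (x y : EuclideanSpace ℝ (Fin 3)) : 0 ≤ covC n t₁ t₂ x y := by
  have hd : |t₂ - t₁| ≤ t₁ + t₂ := abs_le.2 ⟨by linarith, by linarith⟩
  refine mul_nonneg (by norm_num) (intervalIntegral.integral_nonneg (by linarith) ?_)
  intro σ hσ
  refine mehlerK_nonneg (lt_of_lt_of_le ?_ hσ.1) x y
  positivity

theorem covC_le {δ : ℝ} (hδ0 : 0 < δ) (hδ1 : δ ≤ 1 / 2) {n : ℕ} {t₁ t₂ : ℝ}
    (h₁ : 0 ≤ t₁) (h₂ : 0 ≤ t₂) (hne : t₁ ≠ t₂)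
    {x y : EuclideanSpace ℝ (Fin 3)} (hxy : x ≠ y) :
    covC n t₁ t₂ x y ≤
      4 / δ * |t₂ - t₁| ^ (-δ) *
        (Real.exp (-(1 / 8) * ‖x - y‖ ^ 2) * ‖x - y‖ ^ (2 * δ - 1)) := by
  have hd : |t₂ - t₁| ≤ t₁ + t₂ := abs_le.2 ⟨by linarith, by linarith⟩
  have hd0 : 0 < |t₂ - t₁| := abs_pos.2 (sub_ne_zero.2 hne.symm)
  have he : (0 : ℝ) < 2 * (2 : ℝ) ^ (-(n : ℝ)) := by positivity
  set a := |t₂ - t₁| + 2 * (2 : ℝ) ^ (-(n : ℝ)) with ha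
  set b := t₁ + t₂ + 2 * (2 : ℝ) ^ (-(n : ℝ)) with hb
  set G := Real.exp (-(1 / 8) * ‖x - y‖ ^ 2) * ‖x - y‖ ^ (2 * δ - 1) with hG
  have ha0 : 0 < a := by positivity
  have hab : a ≤ b := by linarith
  have hG0 : 0 ≤ G := by positivity
  have hint : IntervalIntegrable (fun σ : ℝ => 8 * G * σ ^ (-1 - δ)) volume a b := by
    refine (intervalIntegral.intervalIntegrable_rpow (Or.inr ?_)).const_mul _
    rw [Set.uIcc_of_le hab]
    exact fun h => absurd h.1 (not_le.2 ha0)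
  have hbound : ‖∫ σ in a..b, mehlerK σ x y‖ ≤ ∫ σ in a..b, 8 * G * σ ^ (-1 - δ) := by
    refine intervalIntegral.norm_integral_le_of_norm_le hab
      (Filter.Eventually.of_forall fun σ hσ => ?_) hint
    have hσ0 : 0 < σ := ha0.trans hσ.1
    rw [Real.norm_of_nonneg (mehlerK_nonneg hσ0 x y)]
    have h := mehlerK_le (α := 1 / 2 - δ) hσ0 (by linarith) (by linarith) hxy
    rwa [show -(2 * (1 / 2 - δ)) = 2 * δ - 1 by ring,
      show 1 / 2 - δ - 3 / 2 = -1 - δ by ring] at h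
  rw [intervalIntegral.integral_const_mul] at hbound
  have hmono : a ^ (-δ) ≤ |t₂ - t₁| ^ (-δ) :=
    Real.rpow_le_rpow_of_nonpos hd0 (by linarith) (by linarith)
  calc covC n t₁ t₂ x y ≤ 1 / 2 * (8 * G * (|t₂ - t₁| ^ (-δ) / δ)) := by
        unfold covC
        gcongr
        refine (Real.le_norm_self _).trans (hbound.trans ?_)
        gcongr
        exact (integral_rpow_neg_one_sub_le ha0 hab hδ0).trans (by gcongr)
    _ = _ := by ring

theorem integrable_exp_neg_mul_norm_sq_mul_norm_rpow {b s : ℝ} (hb : 0 < b) (hs : -3 < s) :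
    Integrable fun y : EuclideanSpace ℝ (Fin 3) => Real.exp (-b * ‖y‖ ^ 2) * ‖y‖ ^ s := by
  refine (integrable_fun_norm_addHaar volume
    (f := fun r : ℝ => Real.exp (-b * r ^ 2) * r ^ s)).2 ?_
  refine (integrableOn_rpow_mul_exp_neg_mul_sq hb (s := 2 + s) (by linarith)).congr_fun ?_
    measurableSet_Ioi
  intro r hr
  have hr' : (0 : ℝ) < r := hr
  simp only [finrank_euclideanSpace, Fintype.card_fin, smul_eq_mul]
  rw [Real.rpow_add hr']
  norm_num
  ring

/-- for every `0 < ε < 1`,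
`∫ (sup_{y₂} 𝒞⁽ⁿ⁾_{t₁,t₂}(y₁+y₂,y₂))³ dy₁ ≤ C_ε |t₂-t₁|^{-ε}`, uniformly in `n ≥ 1`. -/
theorem covC_translated_sup_cube_bound (ε : ℝ) (hε0 : 0 < ε) (hε1 : ε < 1) :
    ∃ C : ℝ, 0 < C ∧
      ∀ t₁ t₂ : ℝ, 0 ≤ t₁ → 0 ≤ t₂ → t₁ ≠ t₂ → ∀ n : ℕ, 1 ≤ n →
        (∫ y₁ : EuclideanSpace ℝ (Fin 3),
            (⨆ y₂ : EuclideanSpace ℝ (Fin 3), covC n t₁ t₂ (y₁ + y₂) y₂) ^ 3) ≤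
          C * |t₂ - t₁| ^ (-ε) := by
  set g : EuclideanSpace ℝ (Fin 3) → ℝ := fun y =>
    Real.exp (-(3 / 8) * ‖y‖ ^ 2) * ‖y‖ ^ (2 * ε - 3) with hg
  have hgint : Integrable g :=
    integrable_exp_neg_mul_norm_sq_mul_norm_rpow (by norm_num) (by linarith)
  have hg0 : 0 ≤ ∫ y, g y := integral_nonneg fun y => by positivity
  refine ⟨(12 / ε) ^ 3 * (∫ y, g y) + 1, by positivity, ?_⟩
  intro t₁ t₂ h₁ h₂ hne n _
  have hd0 : 0 < |t₂ - t₁| := abs_pos.2 (sub_ne_zero.2 hne.symm)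
  have hsup0 : ∀ y₁ : EuclideanSpace ℝ (Fin 3),
      0 ≤ ⨆ y₂ : EuclideanSpace ℝ (Fin 3), covC n t₁ t₂ (y₁ + y₂) y₂ :=
    fun y₁ => Real.iSup_nonneg fun y₂ => covC_nonneg h₁ h₂ _ _
  have hpt : ∀ y₁ : EuclideanSpace ℝ (Fin 3), y₁ ≠ 0 →
      (⨆ y₂ : EuclideanSpace ℝ (Fin 3), covC n t₁ t₂ (y₁ + y₂) y₂) ^ 3 ≤
        (12 / ε) ^ 3 * |t₂ - t₁| ^ (-ε) * g y₁ := by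
    intro y₁ hy
    have hr : 0 < ‖y₁‖ := norm_pos_iff.2 hy
    have hsup : (⨆ y₂ : EuclideanSpace ℝ (Fin 3), covC n t₁ t₂ (y₁ + y₂) y₂) ≤
        4 / (ε / 3) * |t₂ - t₁| ^ (-(ε / 3)) *
          (Real.exp (-(1 / 8) * ‖y₁‖ ^ 2) * ‖y₁‖ ^ (2 * (ε / 3) - 1)) := by
      refine ciSup_le fun y₂ => ?_
      simpa only [add_sub_cancel_right] using
        covC_le (δ := ε / 3) (n := n) (by linarith) (by linarith) h₁ h₂ hne
          (x := y₁ + y₂) (y := y₂) (by simpa using hy)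
    refine (pow_le_pow_left₀ (hsup0 y₁) hsup 3).trans (le_of_eq ?_)
    have e1 : (|t₂ - t₁| ^ (-(ε / 3))) ^ 3 = |t₂ - t₁| ^ (-ε) := by
      rw [← Real.rpow_mul_natCast hd0.le]
      congr 1
      push_cast
      ring
    have e2 : (‖y₁‖ ^ (2 * (ε / 3) - 1)) ^ 3 = ‖y₁‖ ^ (2 * ε - 3) := by
      rw [← Real.rpow_mul_natCast hr.le]
      congr 1
      push_cast
      ring
    have e3 : Real.exp (-(1 / 8) * ‖y₁‖ ^ 2) ^ 3 = Real.exp (-(3 / 8) * ‖y₁‖ ^ 2) := by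
      rw [← Real.exp_nat_mul]
      congr 1
      push_cast
      ring
    rw [mul_pow, mul_pow, mul_pow, e1, e2, e3, show 4 / (ε / 3) = 12 / ε by field_simp; norm_num]
  calc (∫ y₁ : EuclideanSpace ℝ (Fin 3),
        (⨆ y₂ : EuclideanSpace ℝ (Fin 3), covC n t₁ t₂ (y₁ + y₂) y₂) ^ 3)
      ≤ ∫ y₁, (12 / ε) ^ 3 * |t₂ - t₁| ^ (-ε) * g y₁ := by
        refine integral_mono_of_nonneg
          (Filter.Eventually.of_forall fun y => pow_nonneg (hsup0 y) 3) (hgint.const_mul _) ?_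
        filter_upwards [compl_mem_ae_iff.2 (measure_singleton (0 : EuclideanSpace ℝ (Fin 3)))]
          with y hy using hpt y hy
    _ = (12 / ε) ^ 3 * (∫ y, g y) * |t₂ - t₁| ^ (-ε) := by
        rw [integral_const_mul]
        ring
    _ ≤ ((12 / ε) ^ 3 * (∫ y, g y) + 1) * |t₂ - t₁| ^ (-ε) := by
        gcongr
        linarith

end
end

section
/- Let T > 0 and η ∈ (0, 1/2]. There exists a constant C = C(T, η) > 0 such that for all 0 ≤ t₁, t₂ ≤ T with t₁ ≠ t₂, all integers n ≥ 1 and all points w₁, y₁, w₂, y₂ ∈ ℝ³, one has |𝒞⁽ⁿ⁾_{t₁,t₂}(w₁,w₂) − 𝒞⁽ⁿ⁾_{t₁,t₂}(w₁,y₂) − 𝒞⁽ⁿ⁾_{t₁,t₂}(y₁,w₂) + 𝒞⁽ⁿ⁾_{t₁,t₂}(y₁,y₂)| ≤ C · |w₁−y₁|^η · |w₂−y₂|^η · |t₂−t₁|^{−1/2−η}. -/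
open MeasureTheory Real

noncomputable section

theorem sq_integral_mul_le {Ω : Type*} [MeasurableSpace Ω] {μ : Measure Ω} {f g : Ω → ℝ}
    (hff : Integrable (fun z => f z * f z) μ) (hfg : Integrable (fun z => f z * g z) μ)
    (hgg : Integrable (fun z => g z * g z) μ) :
    (∫ z, f z * g z ∂μ) ^ 2 ≤ (∫ z, f z * f z ∂μ) * ∫ z, g z * g z ∂μ := by
  have h : ∀ s : ℝ, 0 ≤ (∫ z, f z * f z ∂μ) * (s * s) + (2 * ∫ z, f z * g z ∂μ) * s +
      ∫ z, g z * g z ∂μ := by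
    intro s
    have hnn : 0 ≤ ∫ z, (s * f z + g z) ^ 2 ∂μ := integral_nonneg fun z => sq_nonneg _
    have he : (fun z => (s * f z + g z) ^ 2) =
        fun z => s * s * (f z * f z) + 2 * s * (f z * g z) + g z * g z := by
      funext z; ring
    have hf := hff.const_mul (s * s)
    have hg := hfg.const_mul (2 * s)
    rw [he, integral_add (hf.fun_add hg) hgg, integral_add hf hg, integral_const_mul,
      integral_const_mul] at hnn
    linarith
  have := discrim_le_zero h
  rw [discrim] at this
  nlinarith

theorem integral_sub_mul_sub {Ω : Type*} [MeasurableSpace Ω] {μ : Measure Ω} {X : Type*}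
    {φ : X → Ω → ℝ} (hφ : ∀ x y, Integrable (fun z => φ x z * φ y z) μ) (a b c d : X) :
    Integrable (fun z => (φ a z - φ b z) * (φ c z - φ d z)) μ ∧
      ∫ z, (φ a z - φ b z) * (φ c z - φ d z) ∂μ =
        (∫ z, φ a z * φ c z ∂μ) - (∫ z, φ a z * φ d z ∂μ) - (∫ z, φ b z * φ c z ∂μ) +
          ∫ z, φ b z * φ d z ∂μ := by
  have he : (fun z => (φ a z - φ b z) * (φ c z - φ d z)) =
      fun z => φ a z * φ c z - φ a z * φ d z - φ b z * φ c z + φ b z * φ d z := by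
    funext z; ring
  rw [he]
  have h₁ : Integrable (fun z => φ a z * φ c z - φ a z * φ d z) μ := (hφ a c).sub (hφ a d)
  have h₂ : Integrable (fun z => φ a z * φ c z - φ a z * φ d z - φ b z * φ c z) μ :=
    h₁.sub (hφ b c)
  refine ⟨h₂.add (hφ b d), ?_⟩
  rw [integral_add h₂ (hφ b d), integral_sub h₁ (hφ b c), integral_sub (hφ a c) (hφ a d)]

/-- A kernel given by a feature map satisfies the Cauchy–Schwarz inequality for
rectangular increments. -/
theorem sq_rectangular_increment_le {Ω : Type*} [MeasurableSpace Ω] {μ : Measure Ω} {X : Type*}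
    {φ : X → Ω → ℝ} {k : X → X → ℝ} (hφ : ∀ x y, Integrable (fun z => φ x z * φ y z) μ)
    (hk : ∀ x y, ∫ z, φ x z * φ y z ∂μ = k x y) (a b c d : X) :
    (k a c - k a d - k b c + k b d) ^ 2 ≤
      (k a a - k a b - k b a + k b b) * (k c c - k c d - k d c + k d d) := by
  have h := sq_integral_mul_le (integral_sub_mul_sub hφ a b a b).1
    (integral_sub_mul_sub hφ a b c d).1 (integral_sub_mul_sub hφ c d c d).1
  rw [(integral_sub_mul_sub hφ a b a b).2, (integral_sub_mul_sub hφ a b c d).2,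
    (integral_sub_mul_sub hφ c d c d).2] at h
  simpa only [hk] using h

theorem integrable_exp_sum_pi_gaussianReal (v : Fin 3 → ℝ) :
    Integrable (fun z : Fin 3 → ℝ => Real.exp (∑ i, v i * z i))
      (Measure.pi fun _ => ProbabilityTheory.gaussianReal 0 1) := by
  simp_rw [Real.exp_sum]
  exact Integrable.fintype_prod_dep (f := fun i x => Real.exp (v i * x)) fun i =>
    ProbabilityTheory.integrable_exp_mul_gaussianReal (v i)

theorem integral_exp_sum_pi_gaussianReal (v : Fin 3 → ℝ) :
    ∫ z : Fin 3 → ℝ, Real.exp (∑ i, v i * z i)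
      ∂(Measure.pi fun _ => ProbabilityTheory.gaussianReal 0 1) =
      Real.exp ((∑ i, v i ^ 2) / 2) := by
  simp_rw [Real.exp_sum]
  rw [integral_fintype_prod_eq_prod (fun i x => Real.exp (v i * x)), Finset.sum_div, Real.exp_sum]
  refine Finset.prod_congr rfl fun i _ => ?_
  have h := ProbabilityTheory.mgf_gaussianReal (p := ProbabilityTheory.gaussianReal 0 1)
    (X := id) (μ := 0) (v := 1) (by simp) (v i)
  simpa [ProbabilityTheory.mgf] using h

/-- The exponential factor of the Mehler kernel, as a function of `τ = tanh t`. -/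
def mehlerExp (τ : ℝ) (x y : EuclideanSpace ℝ (Fin 3)) : ℝ :=
  Real.exp (-‖x - y‖ ^ 2 / (4 * τ) - τ * ‖x + y‖ ^ 2 / 4)

/-- The square-integrable feature map representing `mehlerExp` in `L²` of the standard Gaussian. -/
def mehlerFeature (τ : ℝ) (x : EuclideanSpace ℝ (Fin 3)) (z : Fin 3 → ℝ) : ℝ :=
  Real.exp (-‖x‖ ^ 2 / (2 * τ)) * Real.exp (∑ i, √((1 / τ - τ) / 2) * x i * z i)

theorem mehlerFeature_mul (τ : ℝ) (x y : EuclideanSpace ℝ (Fin 3)) (z : Fin 3 → ℝ) :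
    mehlerFeature τ x z * mehlerFeature τ y z =
      Real.exp (-(‖x‖ ^ 2 + ‖y‖ ^ 2) / (2 * τ)) *
        Real.exp (∑ i, √((1 / τ - τ) / 2) * (x + y) i * z i) := by
  simp only [mehlerFeature, ← Real.exp_add, Fin.sum_univ_three, PiLp.add_apply]
  congr 1
  ring

theorem integrable_mehlerFeature_mul (τ : ℝ) (x y : EuclideanSpace ℝ (Fin 3)) :
    Integrable (fun z => mehlerFeature τ x z * mehlerFeature τ y z)
      (Measure.pi fun _ => ProbabilityTheory.gaussianReal 0 1) := by
  simp_rw [mehlerFeature_mul]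
  exact (integrable_exp_sum_pi_gaussianReal _).const_mul _

theorem integral_mehlerFeature_mul {τ : ℝ} (hτ : 0 < τ) (hτ1 : τ ≤ 1)
    (x y : EuclideanSpace ℝ (Fin 3)) :
    ∫ z, mehlerFeature τ x z * mehlerFeature τ y z
      ∂(Measure.pi fun _ => ProbabilityTheory.gaussianReal 0 1) = mehlerExp τ x y := by
  have hb : 0 ≤ (1 / τ - τ) / 2 := by
    have : 1 ≤ 1 / τ := by rw [le_div_iff₀ hτ]; linarith
    linarith
  simp_rw [mehlerFeature_mul]
  rw [integral_const_mul,
    integral_exp_sum_pi_gaussianReal (fun i => √((1 / τ - τ) / 2) * (x + y) i), mehlerExp,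
    ← Real.exp_add]
  congr 1
  simp_rw [mul_pow, Real.sq_sqrt hb]
  simp only [EuclideanSpace.norm_sq_eq, Fin.sum_univ_three, PiLp.add_apply, PiLp.sub_apply,
    Real.norm_eq_abs, sq_abs]
  field_simp
  ring

theorem abs_exp_neg_sq_sub_le (a b : ℝ) :
    |Real.exp (-a ^ 2 / 2) - Real.exp (-b ^ 2 / 2)| ≤ |a - b| := by
  have hd : ∀ x : ℝ, HasDerivAt (fun x : ℝ => Real.exp (-x ^ 2 / 2))
      (Real.exp (-x ^ 2 / 2) * (-x)) x := by
    intro x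
    have h : HasDerivAt (fun x : ℝ => -x ^ 2 / 2) (-x) x :=
      ((hasDerivAt_pow 2 x).fun_neg.div_const 2).congr_deriv (by norm_num; ring)
    exact h.exp
  have hbd : ∀ x : ℝ, ‖Real.exp (-x ^ 2 / 2) * (-x)‖ ≤ 1 := by
    intro x
    rw [norm_mul, norm_neg, Real.norm_eq_abs, Real.norm_eq_abs, Real.abs_exp]
    have h1 : |x| ≤ Real.exp (x ^ 2 / 2) := by
      have := Real.add_one_le_exp (x ^ 2 / 2)
      nlinarith [sq_nonneg (|x| - 1), sq_abs x]
    calc Real.exp (-x ^ 2 / 2) * |x| ≤ Real.exp (-x ^ 2 / 2) * Real.exp (x ^ 2 / 2) := by gcongr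
      _ = 1 := by rw [← Real.exp_add]; simp [neg_div]
  have := Convex.norm_image_sub_le_of_norm_hasDerivWithin_le (s := Set.univ) (C := 1)
    (fun x _ => (hd x).hasDerivWithinAt) (fun x _ => hbd x) convex_univ
    (Set.mem_univ b) (Set.mem_univ a)
  simpa using this

theorem mehlerExp_comm (τ : ℝ) (x y : EuclideanSpace ℝ (Fin 3)) :
    mehlerExp τ x y = mehlerExp τ y x := by
  rw [mehlerExp, mehlerExp, norm_sub_rev, add_comm x]

theorem mehlerExp_pos (τ : ℝ) (x y : EuclideanSpace ℝ (Fin 3)) : 0 < mehlerExp τ x y :=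
  Real.exp_pos _

theorem mehlerExp_self {τ : ℝ} (hτ : 0 ≤ τ) (x : EuclideanSpace ℝ (Fin 3)) :
    mehlerExp τ x x = Real.exp (-(√τ * ‖x‖) ^ 2 / 2) ^ 2 := by
  have : ‖x + x‖ = 2 * ‖x‖ := by rw [← two_smul ℝ x, norm_smul]; simp
  rw [mehlerExp, ← Real.exp_nat_mul, this, mul_pow √τ, Real.sq_sqrt hτ]
  congr 1
  simp
  ring

theorem mehlerExp_diag_increment_le_two {τ : ℝ} (hτ : 0 < τ)
    (x y : EuclideanSpace ℝ (Fin 3)) :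
    mehlerExp τ x x - mehlerExp τ x y - mehlerExp τ y x + mehlerExp τ y y ≤ 2 := by
  have h : ∀ x y, mehlerExp τ x y ≤ 1 := fun x y => by
    rw [mehlerExp, Real.exp_le_one_iff, neg_div]
    have h1 : 0 ≤ ‖x - y‖ ^ 2 / (4 * τ) := by positivity
    have h2 : 0 ≤ τ * ‖x + y‖ ^ 2 / 4 := by positivity
    linarith
  linarith [h x x, h y y, mehlerExp_pos τ x y, mehlerExp_pos τ y x]

theorem mehlerExp_diag_increment_le {τ : ℝ} (hτ : 0 < τ) (hτ1 : τ ≤ 1)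
    (x y : EuclideanSpace ℝ (Fin 3)) :
    mehlerExp τ x x - mehlerExp τ x y - mehlerExp τ y x + mehlerExp τ y y ≤
      2 * (‖x - y‖ ^ 2 / τ) := by
  set p := Real.exp (-(√τ * ‖x‖) ^ 2 / 2) with hp
  set q := Real.exp (-(√τ * ‖y‖) ^ 2 / 2) with hq
  have hx : mehlerExp τ x x = p ^ 2 := mehlerExp_self hτ.le x
  have hy : mehlerExp τ y y = q ^ 2 := mehlerExp_self hτ.le y
  have hpq : (p - q) ^ 2 ≤ τ * ‖x - y‖ ^ 2 := by
    have h1 : |p - q| ≤ |√τ * ‖x - y‖| := by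
      refine (abs_exp_neg_sq_sub_le _ _).trans ?_
      rw [← mul_sub, abs_mul, abs_mul, abs_norm]
      exact mul_le_mul_of_nonneg_left (abs_norm_sub_norm_le x y) (abs_nonneg _)
    have := sq_le_sq.2 h1
    rwa [mul_pow, Real.sq_sqrt hτ.le] at this
  have hcross : p * q - mehlerExp τ x y ≤ ‖x - y‖ ^ 2 / (4 * τ) := by
    set u := ‖x - y‖ ^ 2 / (4 * τ) with hu
    have hu0 : 0 ≤ u := by positivity
    have hle : p * q * Real.exp (-u) ≤ mehlerExp τ x y := by
      rw [hp, hq, mehlerExp, ← Real.exp_add, ← Real.exp_add, Real.exp_le_exp,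
        neg_div (4 * τ) (‖x - y‖ ^ 2), ← hu, mul_pow, mul_pow, Real.sq_sqrt hτ.le]
      have := parallelogram_law_with_norm ℝ x y
      nlinarith [mul_nonneg hτ.le (sq_nonneg ‖x - y‖)]
    have hpq1 : p * q ≤ 1 := by
      rw [hp, hq, ← Real.exp_add, Real.exp_le_one_iff]
      nlinarith [sq_nonneg (√τ * ‖x‖), sq_nonneg (√τ * ‖y‖)]
    have hpq0 : 0 < p * q := by positivity
    have h2 := Real.add_one_le_exp (-u)
    nlinarith
  have hτu : τ * ‖x - y‖ ^ 2 ≤ ‖x - y‖ ^ 2 / τ := by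
    rw [le_div_iff₀ hτ]
    nlinarith [mul_nonneg (sq_nonneg ‖x - y‖) (show 0 ≤ 1 - τ * τ by nlinarith)]
  have hquarter : ‖x - y‖ ^ 2 / (4 * τ) = ‖x - y‖ ^ 2 / τ / 4 := by
    rw [div_div, mul_comm]
  have : 0 ≤ ‖x - y‖ ^ 2 / τ := by positivity
  rw [mehlerExp_comm τ y x, hx, hy]
  nlinarith

theorem mehlerExp_diag_increment_le_rpow {τ η : ℝ} (hτ : 0 < τ) (hτ1 : τ ≤ 1) (hη0 : 0 ≤ η)
    (hη1 : η ≤ 1) (x y : EuclideanSpace ℝ (Fin 3)) :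
    mehlerExp τ x x - mehlerExp τ x y - mehlerExp τ y x + mehlerExp τ y y ≤
      2 * (‖x - y‖ ^ 2 / τ) ^ η := by
  have h0 : 0 ≤ ‖x - y‖ ^ 2 / τ := by positivity
  rcases le_total (‖x - y‖ ^ 2 / τ) 1 with h | h
  · refine (mehlerExp_diag_increment_le hτ hτ1 x y).trans ?_
    gcongr
    exact Real.self_le_rpow_of_le_one h0 h hη1
  · refine (mehlerExp_diag_increment_le_two hτ x y).trans ?_
    linarith [Real.one_le_rpow h hη0]

theorem abs_mehlerExp_rectangular_increment_le {τ η : ℝ} (hτ : 0 < τ) (hτ1 : τ ≤ 1) (hη0 : 0 ≤ η)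
    (hη1 : η ≤ 1) (a b c d : EuclideanSpace ℝ (Fin 3)) :
    |mehlerExp τ a c - mehlerExp τ a d - mehlerExp τ b c + mehlerExp τ b d| ≤
      2 * ‖a - b‖ ^ η * ‖c - d‖ ^ η * τ ^ (-η) := by
  refine abs_le_of_sq_le_sq ?_ (by positivity)
  have h := sq_rectangular_increment_le (integrable_mehlerFeature_mul τ)
    (integral_mehlerFeature_mul hτ hτ1) a b c d
  have hnn : 0 ≤ mehlerExp τ c c - mehlerExp τ c d - mehlerExp τ d c + mehlerExp τ d d := by
    have := (integral_sub_mul_sub (integrable_mehlerFeature_mul τ) c d c d).2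
    simp only [integral_mehlerFeature_mul hτ hτ1] at this
    rw [← this]
    exact integral_nonneg fun z => mul_self_nonneg _
  refine h.trans ((mul_le_mul (mehlerExp_diag_increment_le_rpow hτ hτ1 hη0 hη1 a b)
    (mehlerExp_diag_increment_le_rpow hτ hτ1 hη0 hη1 c d) hnn (by positivity)).trans_eq ?_)
  rw [Real.div_rpow (by positivity) hτ.le, Real.div_rpow (by positivity) hτ.le,
    ← Real.rpow_pow_comm (norm_nonneg _), ← Real.rpow_pow_comm (norm_nonneg _), Real.rpow_neg hτ.le]
  ring

theorem div_cosh_le_tanh {t M : ℝ} (ht : 0 ≤ t) (htM : t ≤ M) :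
    t / Real.cosh M ≤ Real.tanh t := by
  rw [Real.tanh_eq_sinh_div_cosh]
  have h1 : t ≤ Real.sinh t := Real.self_le_sinh_iff.2 ht
  have h2 : Real.cosh t ≤ Real.cosh M := by
    rw [Real.cosh_le_cosh, abs_of_nonneg ht, abs_of_nonneg (ht.trans htM)]; exact htM
  have := Real.cosh_pos t
  gcongr

theorem abs_mehlerK_rectangular_increment_le {M t η : ℝ} (ht : 0 < t) (htM : t ≤ M) (hη0 : 0 ≤ η)
    (hη1 : η ≤ 1) (a b c d : EuclideanSpace ℝ (Fin 3)) :
    |mehlerK t a c - mehlerK t a d - mehlerK t b c + mehlerK t b d| ≤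
      2 * Real.cosh M ^ η * ‖a - b‖ ^ η * ‖c - d‖ ^ η * t ^ (-(3 : ℝ) / 2 - η) := by
  have hcosh := Real.cosh_pos M
  have hlow := div_cosh_le_tanh ht.le htM
  have hτ : 0 < Real.tanh t := lt_of_lt_of_le (by positivity) hlow
  have hτ1 : Real.tanh t ≤ 1 := (Real.tanh_lt_one t).le
  have hsinh : t ≤ 2 * π * Real.sinh (2 * t) := by
    have h1 : 2 * t ≤ Real.sinh (2 * t) := Real.self_le_sinh_iff.2 (by positivity)
    nlinarith [Real.pi_gt_three]
  have hpre : (2 * π * Real.sinh (2 * t)) ^ (-(3 : ℝ) / 2) ≤ t ^ (-(3 : ℝ) / 2) :=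
    Real.rpow_le_rpow_of_nonpos ht hsinh (by norm_num)
  have hτη : Real.tanh t ^ (-η) ≤ Real.cosh M ^ η * t ^ (-η) := by
    refine (Real.rpow_le_rpow_of_nonpos (by positivity) hlow (by linarith)).trans_eq ?_
    rw [Real.div_rpow ht.le hcosh.le, Real.rpow_neg hcosh.le, div_inv_eq_mul, mul_comm]
  have hpre0 : 0 ≤ (2 * π * Real.sinh (2 * t)) ^ (-(3 : ℝ) / 2) :=
    Real.rpow_nonneg (ht.le.trans hsinh) _
  have hK : mehlerK t a c - mehlerK t a d - mehlerK t b c + mehlerK t b d =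
      (2 * π * Real.sinh (2 * t)) ^ (-(3 : ℝ) / 2) *
        (mehlerExp (Real.tanh t) a c - mehlerExp (Real.tanh t) a d -
          mehlerExp (Real.tanh t) b c + mehlerExp (Real.tanh t) b d) := by
    simp only [mehlerK, mehlerExp]; ring
  rw [hK, abs_mul, abs_of_nonneg hpre0]
  calc _ ≤ t ^ (-(3 : ℝ) / 2) *
        (2 * ‖a - b‖ ^ η * ‖c - d‖ ^ η * (Real.cosh M ^ η * t ^ (-η))) := by
        refine mul_le_mul hpre ?_ (abs_nonneg _) (by positivity)
        refine (abs_mehlerExp_rectangular_increment_le hτ hτ1 hη0 hη1 a b c d).trans ?_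
        gcongr
    _ = _ := by
        rw [sub_eq_add_neg (-(3 : ℝ) / 2) η, Real.rpow_add ht]; ring

theorem intervalIntegrable_mehlerK {a b : ℝ} (ha : 0 < a) (hab : a ≤ b)
    (x y : EuclideanSpace ℝ (Fin 3)) :
    IntervalIntegrable (fun t => mehlerK t x y) volume a b := by
  refine ContinuousOn.intervalIntegrable ?_
  rw [Set.uIcc_of_le hab]
  intro t ht
  have ht0 : 0 < t := ha.trans_le ht.1
  have hs : 0 < Real.sinh (2 * t) := Real.sinh_pos_iff.2 (by positivity)
  have hs' : 0 < Real.sinh t := Real.sinh_pos_iff.2 ht0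
  have hc := Real.cosh_pos t
  refine ContinuousAt.continuousWithinAt ?_
  unfold mehlerK
  simp only [Real.tanh_eq_sinh_div_cosh]
  have hd : 4 * (Real.sinh t / Real.cosh t) ≠ 0 := by positivity
  have hτ : ContinuousAt (fun t => Real.sinh t / Real.cosh t) t :=
    Real.continuous_sinh.continuousAt.div Real.continuous_cosh.continuousAt hc.ne'
  refine ContinuousAt.mul (ContinuousAt.rpow_const ?_ (Or.inl (by positivity))) ?_
  · exact (continuous_const.mul (Real.continuous_sinh.comp (by fun_prop))).continuousAt
  · refine ContinuousAt.rexp (ContinuousAt.sub ?_ ?_)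
    · exact continuousAt_const.div (continuousAt_const.mul hτ) hd
    · exact (hτ.mul continuousAt_const).div_const _

theorem integral_rpow_neg_three_halves_sub_le {a b η : ℝ} (ha : 0 < a) (hab : a ≤ b) (hη : 0 ≤ η) :
    ∫ t in a..b, t ^ (-(3 : ℝ) / 2 - η) ≤ 2 * a ^ (-(1 : ℝ) / 2 - η) := by
  have hmem : (0 : ℝ) ∉ Set.uIcc a b := by
    rw [Set.uIcc_of_le hab]; exact fun h => ha.not_ge h.1
  rw [integral_rpow (Or.inr ⟨by linarith, hmem⟩),
    show -(3 : ℝ) / 2 - η + 1 = -(1 : ℝ) / 2 - η by ring]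
  have hb : 0 ≤ b ^ (-(1 : ℝ) / 2 - η) := Real.rpow_nonneg (ha.le.trans hab) _
  have ha' : 0 ≤ a ^ (-(1 : ℝ) / 2 - η) := Real.rpow_nonneg ha.le _
  rw [div_le_iff_of_neg (by linarith)]
  nlinarith

/-- the rectangular increment of the regularized covariance in the space
variables satisfies a uniform-in-`n` Hölder-type bound. -/
theorem covC_space_rectangular_increment_bound (T : ℝ) (hT : 0 < T)
    (η : ℝ) (hη0 : 0 < η) (hη : η ≤ 1 / 2) :
    ∃ C : ℝ, 0 < C ∧
      ∀ t₁ t₂ : ℝ, 0 ≤ t₁ → t₁ ≤ T → 0 ≤ t₂ → t₂ ≤ T → t₁ ≠ t₂ →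
        ∀ n : ℕ, 1 ≤ n → ∀ w₁ y₁ w₂ y₂ : EuclideanSpace ℝ (Fin 3),
          |covC n t₁ t₂ w₁ w₂ - covC n t₁ t₂ w₁ y₂ - covC n t₁ t₂ y₁ w₂ + covC n t₁ t₂ y₁ y₂| ≤
            C * ‖w₁ - y₁‖ ^ η * ‖w₂ - y₂‖ ^ η * |t₂ - t₁| ^ (-(1 : ℝ) / 2 - η) := by
  set M := 2 * T + 1 with hM
  refine ⟨2 * Real.cosh M ^ η, mul_pos two_pos (Real.rpow_pos_of_pos (Real.cosh_pos M) η), ?_⟩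
  intro t₁ t₂ h₁ h₁T h₂ h₂T hne n hn w₁ y₁ w₂ y₂
  have hδ : 0 < |t₂ - t₁| := abs_pos.2 (sub_ne_zero.2 hne.symm)
  have hε0 : 0 < (2 : ℝ) ^ (-(n : ℝ)) := Real.rpow_pos_of_pos two_pos _
  have hε1 : (2 : ℝ) ^ (-(n : ℝ)) ≤ 1 / 2 := by
    have hn' : (1 : ℝ) ≤ n := by exact_mod_cast hn
    calc (2 : ℝ) ^ (-(n : ℝ)) ≤ (2 : ℝ) ^ (-1 : ℝ) :=
          Real.rpow_le_rpow_of_exponent_le one_le_two (by linarith)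
      _ = 1 / 2 := by rw [Real.rpow_neg_one]; norm_num
  have hle : |t₂ - t₁| ≤ t₁ + t₂ := abs_le.2 ⟨by linarith, by linarith⟩
  unfold covC
  set a := |t₂ - t₁| + 2 * (2 : ℝ) ^ (-(n : ℝ)) with ha
  set b := t₁ + t₂ + 2 * (2 : ℝ) ^ (-(n : ℝ)) with hb
  have ha0 : 0 < a := by positivity
  have hab : a ≤ b := by linarith
  have hbM : b ≤ M := by linarith
  have hint := fun x y => intervalIntegrable_mehlerK ha0 hab x y
  set D := 2 * Real.cosh M ^ η * ‖w₁ - y₁‖ ^ η * ‖w₂ - y₂‖ ^ η with hD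
  have hD0 : 0 ≤ D := by
    have := Real.cosh_pos M
    positivity
  have hbound : |∫ σ in a..b, (mehlerK σ w₁ w₂ - mehlerK σ w₁ y₂ - mehlerK σ y₁ w₂ +
      mehlerK σ y₁ y₂)| ≤ ∫ σ in a..b, D * σ ^ (-(3 : ℝ) / 2 - η) := by
    rw [← Real.norm_eq_abs]
    refine intervalIntegral.norm_integral_le_of_norm_le hab ?_ ?_
    · refine Filter.Eventually.of_forall fun σ hσ => ?_
      exact abs_mehlerK_rectangular_increment_le (ha0.trans hσ.1) (hσ.2.trans hbM) hη0.le
        (by linarith) w₁ y₁ w₂ y₂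
    · refine (intervalIntegral.intervalIntegrable_rpow (Or.inr ?_)).const_mul D
      rw [Set.uIcc_of_le hab]
      exact fun h => ha0.not_ge h.1
  rw [intervalIntegral.integral_add (((hint _ _).sub (hint _ _)).sub (hint _ _)) (hint _ _),
    intervalIntegral.integral_sub ((hint _ _).sub (hint _ _)) (hint _ _),
    intervalIntegral.integral_sub (hint _ _) (hint _ _), intervalIntegral.integral_const_mul]
    at hbound
  rw [← mul_sub, ← mul_sub, ← mul_add, abs_mul, abs_of_pos (by norm_num : (0 : ℝ) < 1 / 2)]
  have hI := integral_rpow_neg_three_halves_sub_le ha0 hab hη0.le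
  have hmono : a ^ (-(1 : ℝ) / 2 - η) ≤ |t₂ - t₁| ^ (-(1 : ℝ) / 2 - η) :=
    Real.rpow_le_rpow_of_nonpos hδ (by linarith) (by linarith)
  have := mul_le_mul_of_nonneg_left (hI.trans (mul_le_mul_of_nonneg_left hmono two_pos.le)) hD0
  linarith


end
end
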